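/- arXiv:1712.03711 — 7 statements merged into one kernel-verified Lean document; each statement's English description precedes it below -/
import Mathlib

section
/- Let A be an associative unital ring, h ∈ A central, and x, d ∈ A with d * x = x * d + h. Then for every natural number n ≥ 1, x^n * d^n = ∏_{i=0}^{n-1} (x*d - i•h). (The factors x*d - i•h pairwise commute, so the product is unambiguous.) -/
/-- If `d * x = x * d + h` and `h` commutes with `d`, then `d ^ n` intertwines
`x * d - n • h` with `x * d`. -/
theorem semiconjBy_pow_mul_sub_nsmul {A : Type*} [Ring A] {h x d : A}
    (hd : Commute h d) (hweyl : d * x = x * d + h) (n : ℕ) :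
    SemiconjBy (d ^ n) (x * d - n • h) (x * d) := by
  induction n with
  | zero => simp
  | succ n ih =>
    have key : SemiconjBy d (x * d - (n + 1) • h) (x * d - n • h) := by
      rw [SemiconjBy, mul_sub, sub_mul, ← mul_assoc, hweyl, add_mul, mul_smul_comm,
        smul_mul_assoc, ← hd.eq, succ_nsmul]
      abel
    rw [pow_succ]
    exact ih.mul_left key

/-- In any associative unital ring `A` with a central element `h` and elements `x`, `d`
satisfying the Weyl relation `d * x = x * d + h`, for every `n ≥ 1` one has
`x ^ n * d ^ n = ∏_{i=0}^{n-1} (x * d - i • h)` (the factors pairwise commute, and we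
take the product in the indicated order). -/
theorem weyl_pow_prod (A : Type*) [Ring A] (h x d : A)
    (hcentral : ∀ a : A, h * a = a * h) (hweyl : d * x = x * d + h)
    (n : ℕ) (hn : 1 ≤ n) :
    x ^ n * d ^ n = ((List.range n).map (fun i : ℕ => x * d - i • h)).prod := by
  clear hn
  induction n with
  | zero => simp
  | succ n ih =>
    rw [List.range_succ, List.map_append, List.prod_append, ← ih, List.map_singleton,
      List.prod_singleton, mul_assoc, (semiconjBy_pow_mul_sub_nsmul (hcentral d) hweyl n).eq,
      pow_succ, pow_succ']
    simp only [mul_assoc]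
end

section
/- Let p be a prime and R a commutative ring with CharP R p. Then for all t, h ∈ R: ∏_{i=0}^{p-1} (t - i•h) = t^p - h^(p-1) * t. -/
open Polynomial in
theorem prod_range_sub_natCast_eq_pow_sub (p : ℕ) (hp : p.Prime) {R : Type*} [CommRing R]
    [CharP R p] (s : R) : ∏ i ∈ Finset.range p, (s - (i : R)) = s ^ p - s := by
  have : Fact p.Prime := ⟨hp⟩
  have key : ∏ a : ZMod p, (X - C a) = (X ^ p - X : (ZMod p)[X]) := by
    have hdeg := FiniteField.X_pow_card_sub_X_natDegree_eq (ZMod p) hp.one_lt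
    have hroots := FiniteField.roots_X_pow_card_sub_X (ZMod p)
    rw [ZMod.card] at hroots
    have hmonic : (X ^ p - X : (ZMod p)[X]).Monic :=
      monic_X_pow_sub (by simpa using hp.one_lt)
    have h := prod_multiset_X_sub_C_of_monic_of_roots_card_eq hmonic (by simp [hroots, hdeg])
    rwa [hroots] at h
  have hrange : ∏ i ∈ Finset.range p, (X - C (i : ZMod p)) = ∏ a : ZMod p, (X - C a) :=
    Finset.prod_bij' (fun i _ => (i : ZMod p)) (fun a _ => a.val) (by simp)
      (by simp [ZMod.val_lt])
      (fun i hi => ZMod.val_cast_of_lt (Finset.mem_range.mp hi)) (by simp) (by simp)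
  have h := congrArg (eval₂ (ZMod.castHom dvd_rfl R) s) (hrange.trans key)
  simpa [eval₂_finsetProd] using h

theorem Field.prod_range_sub_nsmul_eq (p : ℕ) (hp : p.Prime) {K : Type*} [Field K] [CharP K p]
    (t h : K) : ∏ i ∈ Finset.range p, (t - i • h) = t ^ p - h ^ (p - 1) * t := by
  rcases eq_or_ne h 0 with rfl | hh
  · simp [zero_pow (Nat.sub_ne_zero_of_lt hp.one_lt)]
  · have hfactor (i : ℕ) : t - i • h = h * (t / h - i) := by
      rw [nsmul_eq_mul]
      field_simp
    simp_rw [hfactor]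
    rw [Finset.prod_mul_distrib, Finset.prod_const, Finset.card_range,
      prod_range_sub_natCast_eq_pow_sub p hp, mul_sub, ← mul_pow, mul_div_cancel₀ _ hh,
      ← pow_sub_one_mul hp.ne_zero h, mul_assoc, mul_div_cancel₀ _ hh]

/-- The `ℏ`-Artin–Schreier factorization: in a commutative ring `R` of prime
characteristic `p`, for all `t, h ∈ R` one has
`∏_{i=0}^{p-1} (t - i • h) = t ^ p - h ^ (p - 1) * t`. -/
theorem artin_schreier_prod (p : ℕ) (hp : p.Prime) (R : Type*) [CommRing R] [CharP R p]
    (t h : R) :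
    ∏ i ∈ Finset.range p, (t - i • h) = t ^ p - h ^ (p - 1) * t := by
  have : Fact p.Prime := ⟨hp⟩
  let A := MvPolynomial (Fin 2) (ZMod p)
  let φ : A →+* R := MvPolynomial.eval₂Hom (ZMod.castHom dvd_rfl R) ![t, h]
  have hA : ∏ i ∈ Finset.range p, ((MvPolynomial.X 0 : A) - i • MvPolynomial.X 1) =
      MvPolynomial.X 0 ^ p - MvPolynomial.X 1 ^ (p - 1) * MvPolynomial.X 0 := by
    have : CharP (FractionRing A) p :=
      charP_of_injective_algebraMap (IsFractionRing.injective A (FractionRing A)) p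
    apply IsFractionRing.injective A (FractionRing A)
    simpa only [map_prod, map_sub, map_nsmul, map_pow, map_mul] using
      Field.prod_range_sub_nsmul_eq p hp (algebraMap A (FractionRing A) (MvPolynomial.X 0))
        (algebraMap A (FractionRing A) (MvPolynomial.X 1))
  have hφ (j : Fin 2) : φ (MvPolynomial.X j) = ![t, h] j := MvPolynomial.eval₂Hom_X' _ _ j
  simpa [hφ, -nsmul_eq_mul] using congrArg φ hA
end

section
/- Let p be a prime, A an associative unital ring with CharP A p, h ∈ A central, and x, d ∈ A with d * x = x * d + h. Then x^p * d^p = (x*d)^p - h^(p-1) * (x*d). -/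
open Polynomial in
/-- In characteristic `p`, the product of the linear factors `X - i c` over `i < p` is the
homogenized Artin–Schreier polynomial, for a nonzero `c` in a domain. -/
theorem prod_range_X_sub_C_natCast_mul_of_ne_zero {D : Type*} [CommRing D] [IsDomain D] (p : ℕ)
    [Fact p.Prime] [CharP D p] {c : D} (hc : c ≠ 0) :
    ∏ i ∈ Finset.range p, (X - C ((i : D) * c)) = X ^ p - C (c ^ (p - 1)) * X := by
  have hp := Fact.out (p := p.Prime)
  have hlt : (C (c ^ (p - 1)) * X : D[X]).degree < p :=
    (degree_C_mul_X_le _).trans_lt (by exact_mod_cast hp.one_lt)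
  have hmonic : (∏ i ∈ Finset.range p, (X - C ((i : D) * c))).Monic :=
    monic_prod_of_monic _ _ fun i _ ↦ monic_X_sub_C _
  have hdeg : (∏ i ∈ Finset.range p, (X - C ((i : D) * c))).degree = (p : WithBot ℕ) := by
    simp only [degree_prod, degree_X_sub_C, Finset.sum_const, Finset.card_range, nsmul_one]
  have hmonic' : (X ^ p - C (c ^ (p - 1)) * X : D[X]).Monic :=
    (monic_X_pow p).sub_of_left (by rwa [degree_X_pow])
  have hdeg' : (X ^ p - C (c ^ (p - 1)) * X : D[X]).degree = p := by
    rw [degree_sub_eq_left_of_degree_lt (by rwa [degree_X_pow]), degree_X_pow]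
  refine eq_of_degree_sub_lt_of_eval_index_eq (Finset.range p)
    (v := fun i : ℕ ↦ (i : D) * c) ?_ ?_ ?_
  · intro i hi j hj hij
    exact CharP.natCast_injOn_Iio D p (by simpa using hi) (by simpa using hj)
      (mul_right_cancel₀ hc hij)
  · rw [Finset.card_range]
    exact hdeg ▸ degree_sub_lt_left (hdeg.trans hdeg'.symm) hmonic.ne_zero
      (hmonic.leadingCoeff.trans hmonic'.leadingCoeff.symm)
  · intro i hi
    have hfrob : (i : D) ^ p = i := map_natCast (frobenius D p) i
    rw [eval_prod, Finset.prod_eq_zero hi (by simp)]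
    simp only [eval_sub, eval_pow, eval_X, eval_mul, eval_C]
    rw [mul_pow, hfrob, mul_left_comm, pow_sub_one_mul hp.ne_zero, sub_self]

open Polynomial in
/-- In a commutative ring of characteristic `p`, the product of the linear factors `X - i c`
over `i < p` is the homogenized Artin–Schreier polynomial. -/
theorem prod_range_X_sub_C_natCast_mul {R : Type*} [CommRing R] (p : ℕ) [Fact p.Prime]
    [CharP R p] (c : R) :
    ∏ i ∈ Finset.range p, (X - C ((i : R) * c)) = X ^ p - C (c ^ (p - 1)) * X := by
  have key := prod_range_X_sub_C_natCast_mul_of_ne_zero p (X_ne_zero (R := ZMod p))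
  simpa [Polynomial.map_prod] using
    congrArg (Polynomial.map (eval₂RingHom (ZMod.castHom dvd_rfl R) c)) key

/-- Moving a power of `d` past the Euler operator `x * d` shifts the latter by a multiple
of `h`. -/
theorem weyl_mul_mul_pow {A : Type*} [Ring A] {h x d : A} (hcentral : ∀ a : A, h * a = a * h)
    (hweyl : d * x = x * d + h) (n : ℕ) : x * d * d ^ n = d ^ n * (x * d - n * h) := by
  induction n with
  | zero => simp
  | succ n ih =>
    have hstep : x * d * d = d * (x * d - h) := by
      rw [mul_sub, ← mul_assoc d, hweyl, add_mul, hcentral d, add_sub_cancel_right]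
    have hcomm : d * (n * h) = n * h * d := by
      rw [mul_assoc, hcentral d, ← mul_assoc, ← mul_assoc, Nat.cast_comm]
    calc x * d * d ^ (n + 1) = x * d * d ^ n * d := by rw [pow_succ, ← mul_assoc]
      _ = d ^ n * (x * d * d - n * h * d) := by rw [ih, mul_assoc, sub_mul]
      _ = d ^ n * (d * (x * d - h) - d * (n * h)) := by rw [hstep, hcomm]
      _ = d ^ (n + 1) * (x * d - (n + 1 : ℕ) * h) := by
        rw [← mul_sub, ← mul_assoc, ← pow_succ, Nat.cast_succ, add_mul, one_mul,
          sub_sub, add_comm h]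

open Polynomial in
/-- The normally ordered product `x ^ n * d ^ n` is a falling factorial of `x * d` with step `h`,
written as a polynomial over the center. -/
theorem weyl_pow_mul_pow_eq_aeval {A : Type*} [Ring A] (h : Subring.center A) {x d : A}
    (hweyl : d * x = x * d + h) (n : ℕ) :
    x ^ n * d ^ n =
      aeval (x * d) (∏ i ∈ Finset.range n, (X - C ((i : Subring.center A) * h))) := by
  induction n with
  | zero => simp
  | succ n ih =>
    have hcentral (a : A) : (h : A) * a = a * h := (Subring.mem_center_iff.mp h.2 a).symm
    rw [Finset.prod_range_succ, map_mul, ← ih, pow_succ x, pow_succ' d, mul_assoc, ← mul_assoc x,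
      weyl_mul_mul_pow hcentral hweyl, ← mul_assoc, map_sub, aeval_X, aeval_C]
    simp [Algebra.algebraMap_eq_smul_one, Subring.smul_def]

/-- In an associative unital ring `A` of prime characteristic `p`, with a central element
`h` and elements `x`, `d` satisfying the Weyl relation `d * x = x * d + h`, the element
`x ^ p * d ^ p` equals the `ℏ`-Artin–Schreier polynomial evaluated at `x * d`. -/
theorem weyl_pow_artin_schreier (p : ℕ) (hp : p.Prime) (A : Type*) [Ring A] [CharP A p]
    (h x d : A) (hcentral : ∀ a : A, h * a = a * h) (hweyl : d * x = x * d + h) :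
    x ^ p * d ^ p = (x * d) ^ p - h ^ (p - 1) * (x * d) := by
  have : Fact p.Prime := ⟨hp⟩
  let c : Subring.center A := ⟨h, Subring.mem_center_iff.mpr fun a ↦ (hcentral a).symm⟩
  rw [weyl_pow_mul_pow_eq_aeval c hweyl, prod_range_X_sub_C_natCast_mul]
  simp [Algebra.algebraMap_eq_smul_one, Subring.smul_def, c]
end

section
/- Let p be a prime, R a commutative ring, and A, B two R-modules. For any two R-linear maps f, g : A → B, there exists an R-linear map h : A^{⊗p} → B^{⊗p} such that (f+g)^{⊗p} - f^{⊗p} - g^{⊗p} = Σ_{j=0}^{p-1} σ_B^j ∘ h ∘ σ_A^{p-j}. -/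
open scoped TensorProduct

noncomputable section

/-- The cyclic shift `σ_M` on the `p`-th tensor power `M^{⊗p}`, induced by the cyclic
permutation `i ↦ i + 1` of `Fin p`; it satisfies
`σ_M (m_0 ⊗ ⋯ ⊗ m_{p-1}) = m_{p-1} ⊗ m_0 ⊗ ⋯ ⊗ m_{p-2}`. -/
def cyclicShift (R : Type*) [CommRing R] (p : ℕ) (M : Type*) [AddCommGroup M]
    [Module R M] : Module.End R (⨂[R] _ : Fin p, M) :=
  (PiTensorProduct.reindex R (fun _ : Fin p => M) (finRotate p)).toLinearMap

/-- The `p`-th tensor power `f^{⊗p}` of a linear map, applying `f` in every factor. -/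
def tensorPow (R : Type*) [CommRing R] (p : ℕ) {M N : Type*} [AddCommGroup M]
    [Module R M] [AddCommGroup N] [Module R N] (f : M →ₗ[R] N) :
    (⨂[R] _ : Fin p, M) →ₗ[R] (⨂[R] _ : Fin p, N) :=
  PiTensorProduct.map (fun _ : Fin p => f)

theorem finRotate_pow_self {p : ℕ} (hp : 2 ≤ p) : finRotate p ^ p = 1 := by
  have h := Equiv.Perm.lcm_cycleType (finRotate p)
  rw [cycleType_finRotate_of_le hp, Multiset.lcm_singleton, normalize_eq] at h
  exact orderOf_dvd_iff_pow_eq_one.1 h.symm.dvd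

theorem natCast_finRotate {p : ℕ} (i : Fin p) : ((finRotate p i : ℕ) : ZMod p) = (i : ℕ) + 1 := by
  obtain _ | n := p
  · exact i.elim0
  · rw [coe_finRotate]
    split_ifs with h
    · subst h
      simp
    · push_cast
      rfl

section CyclicShift

variable (R : Type*) [CommRing R] (p : ℕ) {M N : Type*} [AddCommGroup M] [Module R M]
  [AddCommGroup N] [Module R N]

theorem cyclicShift_pow_tprod (j : ℕ) (m : Fin p → M) :
    (cyclicShift R p M ^ j) (PiTensorProduct.tprod R m) =
      PiTensorProduct.tprod R fun i => m (((finRotate p)⁻¹ ^ j) i) := by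
  induction j with
  | zero => simp
  | succ j ih =>
    rw [pow_succ', Module.End.mul_apply, ih, pow_succ]
    exact PiTensorProduct.reindex_tprod (finRotate p) _

theorem cyclicShift_pow_self (hp : 2 ≤ p) : cyclicShift R p M ^ p = 1 := by
  refine PiTensorProduct.ext (MultilinearMap.ext fun m => ?_)
  change (cyclicShift R p M ^ p) (PiTensorProduct.tprod R m) = PiTensorProduct.tprod R m
  rw [cyclicShift_pow_tprod, inv_pow, finRotate_pow_self hp]
  rfl

/-- Rotating a mixed tensor power of `f` and `g` rotates the set of factors where `f` is applied. -/
theorem cyclicShift_comp_map_piecewise (f g : M →ₗ[R] N) (s : Finset (Fin p)) :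
    cyclicShift R p N ∘ₗ PiTensorProduct.map (s.piecewise (fun _ => f) fun _ => g) =
      PiTensorProduct.map (((finRotate p).finsetCongr s).piecewise (fun _ => f) fun _ => g) ∘ₗ
        cyclicShift R p M := by
  have h := PiTensorProduct.map_comp_reindex_eq (R := R)
    (s.piecewise (fun _ => f) fun _ => g) (finRotate p)
  refine h.symm.trans ?_
  congr 2
  funext i
  simp only [Finset.piecewise, Equiv.finsetCongr_apply, Finset.mem_map_equiv]

theorem cyclicShift_pow_comp_map_piecewise (f g : M →ₗ[R] N) (s : Finset (Fin p)) (j : ℕ) :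
    (cyclicShift R p N ^ j) ∘ₗ PiTensorProduct.map (s.piecewise (fun _ => f) fun _ => g) =
      PiTensorProduct.map
        ((((finRotate p).finsetCongr ^ j : Equiv.Perm (Finset (Fin p))) s).piecewise
          (fun _ => f) fun _ => g) ∘ₗ (cyclicShift R p M ^ j) := by
  induction j with
  | zero => rfl
  | succ j ih =>
    rw [pow_succ', Module.End.mul_eq_comp, LinearMap.comp_assoc, ih, ← LinearMap.comp_assoc,
      cyclicShift_comp_map_piecewise, LinearMap.comp_assoc, ← Module.End.mul_eq_comp,
      ← pow_succ', pow_succ' ((finRotate p).finsetCongr : Equiv.Perm (Finset (Fin p))),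
      Equiv.Perm.mul_apply]

theorem tensorPow_add_sub (hp : p ≠ 0) (f g : M →ₗ[R] N) :
    tensorPow R p (f + g) - tensorPow R p f - tensorPow R p g =
      ∑ s : Finset (Fin p) with s ≠ ∅ ∧ s ≠ Finset.univ,
        PiTensorProduct.map (s.piecewise (fun _ => f) fun _ => g) := by
  have : NeZero p := ⟨hp⟩
  have h : tensorPow R p (f + g) = ∑ s : Finset (Fin p),
      PiTensorProduct.map (R := R) (s.piecewise (fun _ => f) fun _ => g) :=
    (PiTensorProduct.mapMultilinear R (fun _ : Fin p => M) fun _ => N).map_add_univ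
      (fun _ => f) fun _ => g
  have hs : (Finset.univ.filter fun s : Finset (Fin p) => s ≠ ∅ ∧ s ≠ Finset.univ) =
      (Finset.univ.erase Finset.univ).erase ∅ := by
    ext s
    simp
  rw [h, hs, sub_sub, sub_eq_iff_eq_add', ← Finset.add_sum_erase _ _ (Finset.mem_univ Finset.univ),
    ← Finset.add_sum_erase (Finset.univ.erase Finset.univ) _ (a := ∅)
      (by simpa using Finset.univ_nonempty.ne_empty.symm), add_assoc]
  simp [tensorPow]

end CyclicShift

section Transversal

variable {p : ℕ}

theorem card_finsetCongr_finRotate_pow (j : ℕ) (s : Finset (Fin p)) :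
    (((finRotate p).finsetCongr ^ j : Equiv.Perm (Finset (Fin p))) s).card = s.card := by
  induction j with
  | zero => rfl
  | succ j ih => rw [pow_succ', Equiv.Perm.mul_apply, Equiv.finsetCongr_apply, Finset.card_map, ih]

theorem sum_finsetCongr_finRotate_pow (j : ℕ) (s : Finset (Fin p)) :
    ∑ i ∈ ((finRotate p).finsetCongr ^ j : Equiv.Perm (Finset (Fin p))) s, ((i : ℕ) : ZMod p) =
      ∑ i ∈ s, ((i : ℕ) : ZMod p) + j * s.card := by
  induction j with
  | zero => simp
  | succ j ih =>
    rw [pow_succ', Equiv.Perm.mul_apply, Equiv.finsetCongr_apply, Finset.sum_map]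
    simp only [Equiv.coe_toEmbedding, natCast_finRotate, Finset.sum_add_distrib, ih,
      Finset.sum_const, card_finsetCongr_finRotate_pow, nsmul_eq_mul]
    push_cast
    ring

/-- The nonempty proper subsets of `Fin p` whose elements sum to zero modulo `p` meet every
orbit of the cyclic rotation of such subsets exactly once. -/
theorem sum_finsetCongr_finRotate_orbits (hp : p.Prime) {E : Type*} [AddCommMonoid E]
    (F : Finset (Fin p) → E) :
    ∑ j ∈ Finset.range p,
        ∑ s : Finset (Fin p) with
            (s ≠ ∅ ∧ s ≠ Finset.univ) ∧ ∑ i ∈ s, (((i : Fin p) : ℕ) : ZMod p) = 0,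
          F (((finRotate p).finsetCongr ^ j : Equiv.Perm (Finset (Fin p))) s) =
      ∑ s : Finset (Fin p) with s ≠ ∅ ∧ s ≠ Finset.univ, F s := by
  have : Fact p.Prime := ⟨hp⟩
  have hproper (s : Finset (Fin p)) : (s ≠ ∅ ∧ s ≠ Finset.univ) ↔ (s.card : ZMod p) ≠ 0 := by
    rw [Ne, Ne, ← Finset.card_eq_zero, ← Finset.card_eq_iff_eq_univ, Fintype.card_fin, Ne,
      ZMod.natCast_eq_zero_iff]
    have hle : s.card ≤ p := by simpa using s.card_le_univ
    constructor
    · rintro ⟨h0, h1⟩ hdvd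
      exact h1 (hle.antisymm (Nat.le_of_dvd (Nat.pos_of_ne_zero h0) hdvd))
    · intro h
      exact ⟨fun h0 => h (h0 ▸ dvd_zero p), fun h1 => h h1.symm.dvd⟩
  simp only [hproper]
  have hshift (j : ℕ) :
      ∑ s : Finset (Fin p) with (s.card : ZMod p) ≠ 0 ∧ ∑ i ∈ s, (((i : Fin p) : ℕ) : ZMod p) = 0,
          F (((finRotate p).finsetCongr ^ j : Equiv.Perm (Finset (Fin p))) s) =
        ∑ s : Finset (Fin p) with (s.card : ZMod p) ≠ 0,
          if (j : ZMod p) = (∑ i ∈ s, (((i : Fin p) : ℕ) : ZMod p)) / s.card then F s else 0 := by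
    rw [← Finset.sum_filter, Finset.filter_filter]
    refine Finset.sum_equiv ((finRotate p).finsetCongr ^ j : Equiv.Perm (Finset (Fin p)))
      (fun s => ?_) fun _ _ => rfl
    simp only [Finset.mem_filter, Finset.mem_univ, true_and, card_finsetCongr_finRotate_pow,
      sum_finsetCongr_finRotate_pow]
    refine and_congr_right fun hs => ?_
    rw [eq_div_iff hs, right_eq_add]
  simp only [hshift]
  rw [Finset.sum_comm]
  refine Finset.sum_congr rfl fun s _ => ?_
  set c := (∑ i ∈ s, (((i : Fin p) : ℕ) : ZMod p)) / (s.card : ZMod p)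
  rw [Finset.sum_eq_single_of_mem c.val (Finset.mem_range.2 c.val_lt), if_pos (by simp)]
  intro j hj hne
  refine if_neg fun h => hne ?_
  rw [← h, ZMod.val_cast_of_lt (Finset.mem_range.1 hj)]

end Transversal

/-- The deviation from additivity of the `p`-th tensor power construction is an induced
(averaged) map: for linear maps `f, g : A → B` there is a linear map
`h : A^{⊗p} → B^{⊗p}` with
`(f+g)^{⊗p} - f^{⊗p} - g^{⊗p} = Σ_{j=0}^{p-1} σ_B^j ∘ h ∘ σ_A^(p-j)`. -/
theorem tensorPow_add_sub_induced (p : ℕ) (hp : p.Prime) (R : Type*) [CommRing R]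
    (A B : Type*) [AddCommGroup A] [Module R A] [AddCommGroup B] [Module R B]
    (f g : A →ₗ[R] B) :
    ∃ h : (⨂[R] _ : Fin p, A) →ₗ[R] (⨂[R] _ : Fin p, B),
      tensorPow R p (f + g) - tensorPow R p f - tensorPow R p g =
        ∑ j ∈ Finset.range p,
          (((cyclicShift R p B) ^ j) ∘ₗ h ∘ₗ ((cyclicShift R p A) ^ (p - j))) := by
  have hshift (j : ℕ) (hj : j ∈ Finset.range p) (s : Finset (Fin p)) :
      (cyclicShift R p B ^ j) ∘ₗ PiTensorProduct.map (s.piecewise (fun _ => f) fun _ => g) ∘ₗ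
          (cyclicShift R p A ^ (p - j)) =
        PiTensorProduct.map
          ((((finRotate p).finsetCongr ^ j : Equiv.Perm (Finset (Fin p))) s).piecewise
            (fun _ => f) fun _ => g) := by
    rw [← LinearMap.comp_assoc, cyclicShift_pow_comp_map_piecewise, LinearMap.comp_assoc,
      ← Module.End.mul_eq_comp, ← pow_add, Nat.add_sub_cancel' (Finset.mem_range.1 hj).le,
      cyclicShift_pow_self R p hp.two_le, Module.End.one_eq_id, LinearMap.comp_id]
  refine ⟨∑ s : Finset (Fin p) with
      (s ≠ ∅ ∧ s ≠ Finset.univ) ∧ ∑ i ∈ s, (((i : Fin p) : ℕ) : ZMod p) = 0,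
    PiTensorProduct.map (s.piecewise (fun _ => f) fun _ => g), ?_⟩
  rw [tensorPow_add_sub R p hp.ne_zero, ← sum_finsetCongr_finRotate_orbits hp]
  refine Finset.sum_congr rfl fun j hj => ?_
  rw [Finset.sum_congr rfl fun s _ => (hshift j hj s).symm]
  ext
  simp

end
end

section
/- Let p be a prime, R a commutative ring, and A, B two R-modules. Let i_A : A → A ⊕ B and i_B : B → A ⊕ B be the canonical inclusions. Then the R-linear map T(A) ⊕ T(B) → T(A ⊕ B) given by T(i_A) on the first summand and T(i_B) on the second summand is bijective. -/
open scoped TensorProduct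

noncomputable section

/-- The norm operator `N_M := Σ_{j=0}^{p-1} σ_M^j` on `M^{⊗p}`. -/
def normOp (R : Type*) [CommRing R] (p : ℕ) (M : Type*) [AddCommGroup M] [Module R M] :
    Module.End R (⨂[R] _ : Fin p, M) :=
  ∑ j ∈ Finset.range p, (cyclicShift R p M) ^ j

/-- The kernel of `id - σ_M` inside `M^{⊗p}`. -/
def kerShift (R : Type*) [CommRing R] (p : ℕ) (M : Type*) [AddCommGroup M]
    [Module R M] : Submodule R (⨂[R] _ : Fin p, M) :=
  LinearMap.ker (LinearMap.id - cyclicShift R p M)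

/-- The image of the norm `N_M`, viewed as a submodule of `ker (id - σ_M)`. -/
def normImage (R : Type*) [CommRing R] (p : ℕ) (M : Type*) [AddCommGroup M]
    [Module R M] : Submodule R (kerShift R p M) :=
  Submodule.comap (kerShift R p M).subtype (LinearMap.range (normOp R p M))

/-- The Tate construction `T(M) := ker (id - σ_M) / im (N_M)`. -/
abbrev Tate (R : Type*) [CommRing R] (p : ℕ) (M : Type*) [AddCommGroup M]
    [Module R M] : Type _ :=
  kerShift R p M ⧸ normImage R p M

namespace Tate

section Functoriality

variable {R : Type*} [CommRing R] {p : ℕ} {M N : Type*} [AddCommGroup M] [Module R M]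
  [AddCommGroup N] [Module R N]

theorem mem_kerShift_iff {x : ⨂[R] _ : Fin p, M} :
    x ∈ kerShift R p M ↔ cyclicShift R p M x = x := by
  rw [kerShift, LinearMap.mem_ker, LinearMap.sub_apply, sub_eq_zero, LinearMap.id_apply, eq_comm]

theorem cyclicShift_map (f : Fin p → (M →ₗ[R] N)) (x : ⨂[R] _ : Fin p, M) :
    cyclicShift R p N (PiTensorProduct.map f x) =
      PiTensorProduct.map (fun i ↦ f ((finRotate p).symm i)) (cyclicShift R p M x) :=
  (PiTensorProduct.map_reindex f (finRotate p) x).symm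

theorem cyclicShift_pow_tensorPow (f : M →ₗ[R] N) (j : ℕ) (x : ⨂[R] _ : Fin p, M) :
    (cyclicShift R p N ^ j) (tensorPow R p f x) =
      tensorPow R p f ((cyclicShift R p M ^ j) x) := by
  induction j with
  | zero => rfl
  | succ j ih =>
    rw [pow_succ', pow_succ', Module.End.mul_apply, Module.End.mul_apply, ih]
    exact cyclicShift_map (fun _ ↦ f) _

theorem normOp_tensorPow (f : M →ₗ[R] N) (x : ⨂[R] _ : Fin p, M) :
    normOp R p N (tensorPow R p f x) = tensorPow R p f (normOp R p M x) := by
  simp [normOp, LinearMap.sum_apply, cyclicShift_pow_tensorPow]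

theorem tensorPow_mem_kerShift (f : M →ₗ[R] N) {x : ⨂[R] _ : Fin p, M}
    (hx : x ∈ kerShift R p M) : tensorPow R p f x ∈ kerShift R p N := by
  rw [mem_kerShift_iff] at hx ⊢
  simpa [hx] using cyclicShift_pow_tensorPow f 1 x

variable (R p) in
/-- The map `T(f)` induced by a linear map `f` on Tate constructions. -/
def map (f : M →ₗ[R] N) : Tate R p M →ₗ[R] Tate R p N :=
  Submodule.mapQ _ _ ((tensorPow R p f).restrict fun _ ↦ tensorPow_mem_kerShift f) <| by
    rintro x ⟨y, hy⟩
    exact ⟨tensorPow R p f y, by rw [normOp_tensorPow, hy]; rfl⟩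

theorem map_mk (f : M →ₗ[R] N) (x : kerShift R p M) :
    map R p f (Submodule.Quotient.mk x) =
      Submodule.Quotient.mk ⟨tensorPow R p f x, tensorPow_mem_kerShift f x.2⟩ := rfl

theorem tensorPow_comp {L : Type*} [AddCommGroup L] [Module R L] (g : N →ₗ[R] L)
    (f : M →ₗ[R] N) (x : ⨂[R] _ : Fin p, M) :
    tensorPow R p g (tensorPow R p f x) = tensorPow R p (g ∘ₗ f) x := by
  simp only [tensorPow, PiTensorProduct.map_comp, LinearMap.comp_apply]

theorem map_map {L : Type*} [AddCommGroup L] [Module R L] (g : N →ₗ[R] L)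
    (f : M →ₗ[R] N) (x : Tate R p M) : map R p g (map R p f x) = map R p (g ∘ₗ f) x := by
  obtain ⟨x, rfl⟩ := Submodule.Quotient.mk_surjective _ x
  simp only [map_mk, tensorPow_comp]

theorem map_id (x : Tate R p M) : map R p (LinearMap.id : M →ₗ[R] M) x = x := by
  obtain ⟨x, rfl⟩ := Submodule.Quotient.mk_surjective _ x
  simp only [map_mk, tensorPow, PiTensorProduct.map_id, LinearMap.id_apply]

theorem tensorPow_zero [NeZero p] : tensorPow R p (0 : M →ₗ[R] N) = 0 :=
  (PiTensorProduct.mapMultilinear R (fun _ : Fin p ↦ M) (fun _ ↦ N)).map_coord_zero 0 rfl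

theorem map_zero [NeZero p] (x : Tate R p M) : map R p (0 : M →ₗ[R] N) x = 0 := by
  obtain ⟨x, rfl⟩ := Submodule.Quotient.mk_surjective _ x
  simp only [map_mk, tensorPow_zero, LinearMap.zero_apply]
  rfl

end Functoriality

section Rotation

variable {p : ℕ}

theorem natCast_finRotate (i : Fin p) : ((finRotate p i : ℕ) : ZMod p) = (i : ℕ) + 1 := by
  obtain _ | n := p
  · exact i.elim0
  · rw [finRotate_apply, Fin.val_add]
    simp

theorem natCast_finRotate_pow (j : ℕ) (i : Fin p) :
    (((finRotate p ^ j) i : ℕ) : ZMod p) = (i : ℕ) + j := by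
  induction j with
  | zero => simp
  | succ j ih =>
    rw [pow_succ', Equiv.Perm.mul_apply, natCast_finRotate, ih]
    push_cast
    ring

/-- The sum modulo `p` of the positions at which a two-colouring of `Fin p` is `true`. -/
def weight (c : Fin p → Bool) : ZMod p := ∑ i, if c i then ((i : ℕ) : ZMod p) else 0

theorem weight_comp_finRotate_pow (c : Fin p → Bool) (j : ℕ) :
    weight (fun i ↦ c ((finRotate p ^ j) i)) =
      weight c - j * (Finset.univ.filter fun i ↦ c i = true).card := by
  have h : weight (fun i ↦ c ((finRotate p ^ j) i)) =
      ∑ i, if c i then ((i : ℕ) : ZMod p) - j else 0 := by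
    rw [weight, ← Equiv.sum_comp (finRotate p ^ j)
      fun i ↦ if c i then ((i : ℕ) : ZMod p) - j else 0]
    exact Finset.sum_congr rfl fun i _ ↦ by rw [natCast_finRotate_pow, add_sub_cancel_right]
  rw [h, weight, ← Finset.sum_filter, ← Finset.sum_filter, Finset.sum_sub_distrib,
    Finset.sum_const, nsmul_eq_mul, mul_comm]

/-- A non-constant two-colouring of `Fin p` has exactly one rotation of weight zero. -/
theorem existsUnique_weight_eq_zero [Fact p.Prime] {c : Fin p → Bool}
    (ht : c ≠ fun _ ↦ true) (hf : c ≠ fun _ ↦ false) :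
    ∃! j, j ∈ Finset.range p ∧ weight (fun i ↦ c ((finRotate p ^ j) i)) = 0 := by
  set k := (Finset.univ.filter fun i ↦ c i = true).card with hk
  have hk0 : 0 < k := by
    rw [hk, Finset.card_pos]
    by_contra h
    apply hf
    simpa [Finset.filter_eq_empty_iff, funext_iff] using h
  have hkp : k < p := by
    refine lt_of_le_of_ne (by simpa using Finset.card_le_univ (α := Fin p) _) fun h ↦ ht ?_
    have := (Finset.card_eq_iff_eq_univ (α := Fin p) _).1 (h.trans (Fintype.card_fin p).symm)
    simpa [Finset.filter_eq_self, funext_iff] using this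
  have hk' : (k : ZMod p) ≠ 0 := by
    rw [Ne, ZMod.natCast_eq_zero_iff]
    exact Nat.not_dvd_of_pos_of_lt hk0 hkp
  simp only [weight_comp_finRotate_pow, ← hk, sub_eq_zero, Finset.mem_range]
  refine ⟨(weight c / k).val, ⟨ZMod.val_lt _, ?_⟩, ?_⟩
  · rw [ZMod.natCast_zmod_val, div_mul_cancel₀ _ hk']
  · rintro j ⟨hj, h⟩
    rw [h, mul_div_cancel_right₀ _ hk', ZMod.val_cast_of_lt hj]

end Rotation

section Prod

variable {R : Type*} [CommRing R] {p : ℕ} {A B : Type*} [AddCommGroup A] [Module R A]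
  [AddCommGroup B] [Module R B]

variable (R A B) in
/-- The projector of `A × B` onto one of its two factors, `true` standing for `A`. -/
def factorProj (b : Bool) : (A × B) →ₗ[R] (A × B) :=
  if b then LinearMap.inl R A B ∘ₗ LinearMap.fst R A B
  else LinearMap.inr R A B ∘ₗ LinearMap.snd R A B

variable (R A B) in
/-- The projector of `(A × B)^{⊗p}` onto the mixed tensor product prescribed by a colouring. -/
def mixedProj (c : Fin p → Bool) : Module.End R (⨂[R] _ : Fin p, A × B) :=
  PiTensorProduct.map fun i ↦ factorProj R A B (c i)

theorem sum_mixedProj (x : ⨂[R] _ : Fin p, A × B) : ∑ c, mixedProj R A B c x = x := by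
  have hsum : ∑ b, factorProj R A B b = LinearMap.id := by
    ext <;> simp [factorProj]
  have h := (PiTensorProduct.mapMultilinear R (fun _ : Fin p ↦ A × B)
    (fun _ ↦ A × B)).map_sum (fun _ b ↦ factorProj R A B b)
  simp only [hsum, PiTensorProduct.mapMultilinear_apply, PiTensorProduct.map_id] at h
  simpa only [LinearMap.sum_apply, LinearMap.id_apply, mixedProj] using
    (LinearMap.congr_fun h x).symm

theorem cyclicShift_pow_mixedProj {x : ⨂[R] _ : Fin p, A × B} (hx : x ∈ kerShift R p (A × B))
    (j : ℕ) (c : Fin p → Bool) :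
    (cyclicShift R p (A × B) ^ j) (mixedProj R A B (fun i ↦ c ((finRotate p ^ j) i)) x) =
      mixedProj R A B c x := by
  induction j generalizing c with
  | zero => rfl
  | succ j ih =>
    rw [pow_succ', Module.End.mul_apply]
    have := ih (fun i ↦ c (finRotate p i))
    simp only [← Equiv.Perm.mul_apply, ← pow_succ'] at this
    rw [this, mixedProj, cyclicShift_map, mem_kerShift_iff.1 hx]
    simp only [Equiv.apply_symm_apply, mixedProj]

theorem sub_mem_range_normOp [Fact p.Prime] {x : ⨂[R] _ : Fin p, A × B}
    (hx : x ∈ kerShift R p (A × B)) :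
    x - (mixedProj R A B (fun _ ↦ true) x + mixedProj R A B (fun _ ↦ false) x) ∈
      LinearMap.range (normOp R p (A × B)) := by
  classical
  set S : Finset (Fin p → Bool) := {fun _ ↦ true, fun _ ↦ false} with hS
  have hne : (fun _ : Fin p ↦ true) ≠ fun _ ↦ false :=
    fun h ↦ by simpa using congrFun h ⟨0, (Fact.out : p.Prime).pos⟩
  have hx' : x - (mixedProj R A B (fun _ ↦ true) x + mixedProj R A B (fun _ ↦ false) x) =
      ∑ c ∈ Sᶜ, mixedProj R A B c x := by
    rw [sub_eq_iff_eq_add, ← Finset.sum_pair (f := fun c ↦ mixedProj R A B c x) hne,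
      Finset.sum_compl_add_sum, sum_mixedProj]
  have hrot (j : ℕ) (c : Fin p → Bool) : (fun i ↦ c ((finRotate p ^ j) i)) ∈ Sᶜ ↔ c ∈ Sᶜ := by
    have (b : Bool) : (fun i ↦ c ((finRotate p ^ j) i)) = (fun _ ↦ b) ↔ c = fun _ ↦ b := by
      simp only [funext_iff]
      exact (finRotate p ^ j).forall_congr_right (q := fun i ↦ c i = b)
    simp [hS, this]
  rw [hx']
  refine ⟨∑ c ∈ Sᶜ, if weight c = 0 then mixedProj R A B c x else 0, ?_⟩
  have hj (j : ℕ) : (cyclicShift R p (A × B) ^ j)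
      (∑ c ∈ Sᶜ, if weight c = 0 then mixedProj R A B c x else 0) =
      ∑ c ∈ Sᶜ, if weight (fun i ↦ c ((finRotate p ^ j) i)) = 0
        then mixedProj R A B c x else 0 := by
    rw [map_sum]
    refine (Finset.sum_equiv ((finRotate p ^ j).symm.arrowCongr (Equiv.refl Bool))
      (fun c ↦ (hrot j c).symm) fun c _ ↦ ?_).symm
    change _ = (cyclicShift R p (A × B) ^ j)
      (if weight (fun i ↦ c ((finRotate p ^ j) i)) = 0
        then mixedProj R A B (fun i ↦ c ((finRotate p ^ j) i)) x else 0)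
    split_ifs
    · rw [cyclicShift_pow_mixedProj hx]
    · rw [_root_.map_zero]
  rw [normOp, LinearMap.sum_apply, Finset.sum_congr rfl fun j _ ↦ hj j, Finset.sum_comm]
  refine Finset.sum_congr rfl fun c hc ↦ ?_
  simp only [hS, Finset.mem_compl, Finset.mem_insert, Finset.mem_singleton, not_or] at hc
  obtain ⟨j, ⟨hjp, hj0⟩, huniq⟩ := existsUnique_weight_eq_zero hc.1 hc.2
  rw [Finset.sum_eq_single_of_mem j hjp fun i hi hij ↦ if_neg fun h ↦ hij (huniq i ⟨hi, h⟩),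
    if_pos hj0]

theorem map_inl_fst_add_map_inr_snd [Fact p.Prime] (x : Tate R p (A × B)) :
    map R p (LinearMap.inl R A B) (map R p (LinearMap.fst R A B) x) +
      map R p (LinearMap.inr R A B) (map R p (LinearMap.snd R A B) x) = x := by
  obtain ⟨x, rfl⟩ := Submodule.Quotient.mk_surjective _ x
  rw [map_map, map_map, map_mk, map_mk, ← Submodule.Quotient.mk_add, eq_comm,
    Submodule.Quotient.eq]
  exact sub_mem_range_normOp x.2

end Prod

end Tate

/-- The Tate construction preserves direct sums: with `i_A : A → A ⊕ B` and
`i_B : B → A ⊕ B` the canonical inclusions, the induced map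
`T(i_A) ⊕ T(i_B) : T(A) ⊕ T(B) → T(A ⊕ B)` is bijective. The maps `T(i_A)` and
`T(i_B)` are characterized by commuting with the quotient maps. -/
theorem tate_prod_bijective (p : ℕ) (hp : p.Prime) (R : Type*) [CommRing R]
    (A B : Type*) [AddCommGroup A] [Module R A] [AddCommGroup B] [Module R B] :
    ∃ (TiA : Tate R p A →ₗ[R] Tate R p (A × B))
      (TiB : Tate R p B →ₗ[R] Tate R p (A × B)),
      (∀ (v : kerShift R p A) (w : kerShift R p (A × B)),
        (w : ⨂[R] _ : Fin p, A × B) = tensorPow R p (LinearMap.inl R A B) v →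
          TiA (Submodule.Quotient.mk v) = Submodule.Quotient.mk w) ∧
      (∀ (v : kerShift R p B) (w : kerShift R p (A × B)),
        (w : ⨂[R] _ : Fin p, A × B) = tensorPow R p (LinearMap.inr R A B) v →
          TiB (Submodule.Quotient.mk v) = Submodule.Quotient.mk w) ∧
      Function.Bijective (TiA.coprod TiB) := by
  have : Fact p.Prime := ⟨hp⟩
  have : NeZero p := ⟨hp.ne_zero⟩
  refine ⟨Tate.map R p (LinearMap.inl R A B), Tate.map R p (LinearMap.inr R A B),
    fun v w h ↦ ?_, fun v w h ↦ ?_, ?_⟩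
  · rw [Tate.map_mk]
    exact congrArg _ (Subtype.ext h.symm)
  · rw [Tate.map_mk]
    exact congrArg _ (Subtype.ext h.symm)
  · refine Function.bijective_iff_has_inverse.2
      ⟨fun x ↦ (Tate.map R p (LinearMap.fst R A B) x, Tate.map R p (LinearMap.snd R A B) x),
        fun ⟨a, b⟩ ↦ ?_, Tate.map_inl_fst_add_map_inr_snd⟩
    simp [Tate.map_map, Tate.map_id, Tate.map_zero, LinearMap.fst_comp_inl,
      LinearMap.fst_comp_inr, LinearMap.snd_comp_inl, LinearMap.snd_comp_inr]

end
end

section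
/- Let R be a commutative ring, A an R-module, p ≥ 1 an integer, and g an R-linear automorphism of A with g^p = id. Fix t ∈ ℕ. On A^{⊗p}, let s := σ_A be the cyclic shift, let Φ be the R-linear map induced by applying g^{j·t} in the j-th tensor factor (for j = 0, 1, …, p-1), and let D be the R-linear map induced by applying g^t in every tensor factor. Then Φ ∘ s = s ∘ D ∘ Φ. -/
open scoped TensorProduct

noncomputable section

/-- If `a ^ p = 1`, the exponent `i` of `a` may be shifted cyclically in `Fin p`. -/
theorem pow_finRotate_of_pow_eq_one {G : Type*} [Monoid G] {a : G} {p : ℕ}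
    (ha : a ^ p = 1) (i : Fin p) : a ^ (finRotate p i : ℕ) = a * a ^ (i : ℕ) := by
  cases p with
  | zero => exact i.elim0
  | succ n =>
    rw [coe_finRotate, ← pow_succ']
    split_ifs with h
    · rw [h, Fin.val_last, ha, pow_zero]
    · rfl

/-- The intertwining identity behind the Artin–Schreier computation: if `g` is a linear
automorphism of `A` with `g^p = 1`, `s` is the cyclic shift on `A^{⊗p}`, `Φ` applies
`g^{j·t}` in the `j`-th tensor factor, and `D` applies `g^t` in every factor, then
`Φ ∘ s = s ∘ D ∘ Φ`. -/
theorem twisted_diagonal_intertwines (R : Type*) [CommRing R] (A : Type*)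
    [AddCommGroup A] [Module R A] (p : ℕ) (hp : 1 ≤ p)
    (g : Module.End R A) (hg : g ^ p = 1) (t : ℕ) :
    (PiTensorProduct.map (fun j : Fin p => g ^ ((j : ℕ) * t))) ∘ₗ cyclicShift R p A =
      cyclicShift R p A ∘ₗ (PiTensorProduct.map (fun _ : Fin p => g ^ t)) ∘ₗ
        (PiTensorProduct.map (fun j : Fin p => g ^ ((j : ℕ) * t))) := by
  ext m
  simp only [cyclicShift, LinearMap.compMultilinearMap_apply, LinearMap.comp_apply,
    LinearEquiv.coe_coe, PiTensorProduct.reindex_tprod, PiTensorProduct.map_tprod]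
  congr 1
  funext j
  obtain ⟨i, rfl⟩ := (finRotate p).surjective j
  have hgt : (g ^ t) ^ p = 1 := by rw [← pow_mul, mul_comm, pow_mul, hg, one_pow]
  rw [Equiv.symm_apply_apply, mul_comm, pow_mul, pow_finRotate_of_pow_eq_one hgt,
    mul_comm (i : ℕ), pow_mul, Module.End.mul_apply]

end
end

section
/- Let A be an associative unital ring, h ∈ A central, and x, d ∈ A with d * x = x * d + h. Then for all natural numbers r, n, m: (∏_{i=1}^{nr} (r•(x*d) - i•h)) * x^n * (∏_{i=1}^{mr} (r•(x*d) - i•h)) * x^m = (∏_{i=1}^{(n+m)r} (r•(x*d) - i•h)) * x^{n+m}. (The factors r•(x*d) - i•h pairwise commute, so the products are unambiguous.) -/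
/-- Moving `x ^ n` to the right past a factor shifts its index by `n * r`. -/
lemma weyl_pow_semiconjBy {A : Type*} [Ring A] {h x d : A}
    (hcentral : ∀ a : A, h * a = a * h) (hweyl : d * x = x * d + h) (r n i : ℕ) :
    SemiconjBy (x ^ n) (r • (x * d) - i • h) (r • (x * d) - (n * r + i) • h) := by
  induction n generalizing i with
  | zero => simp
  | succ n ih =>
    have hx : SemiconjBy x (r • (x * d) - i • h) (r • (x * d) - (r + i) • h) := by
      have hxd : x * d * x = x * (x * d) + x * h := by rw [mul_assoc, hweyl, mul_add]
      simp only [SemiconjBy, mul_sub, sub_mul, mul_smul_comm, smul_mul_assoc, hxd, hcentral x]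
      simp only [smul_add, add_smul]
      abel
    have hn := (ih (r + i)).mul_left hx
    rwa [← pow_succ, ← add_assoc, ← Nat.succ_mul] at hn

lemma SemiconjBy.list_prod_map {M ι : Type*} [Monoid M] {a : M} {f g : ι → M}
    (hfg : ∀ i, SemiconjBy a (f i) (g i)) (l : List ι) :
    SemiconjBy a (l.map f).prod (l.map g).prod := by
  induction l with
  | nil => simp
  | cons i l ih => simpa using (hfg i).mul_right ih

/-- The multiplication rule in the rank-one Coulomb branch with matter: in an associative
unital ring `A` with central `h` and `d * x = x * d + h`, for all `r, n, m`:
`(∏_{i=1}^{nr} (r•(x*d) - i•h)) * x^n * (∏_{i=1}^{mr} (r•(x*d) - i•h)) * x^m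
  = (∏_{i=1}^{(n+m)r} (r•(x*d) - i•h)) * x^(n+m)`
(the factors pairwise commute; products are taken in the indicated order). -/
theorem coulomb_rank_one_mul (A : Type*) [Ring A] (h x d : A)
    (hcentral : ∀ a : A, h * a = a * h) (hweyl : d * x = x * d + h)
    (r n m : ℕ) :
    ((List.range (n * r)).map (fun i : ℕ => r • (x * d) - (i + 1) • h)).prod * x ^ n *
      (((List.range (m * r)).map (fun i : ℕ => r • (x * d) - (i + 1) • h)).prod * x ^ m) =
    ((List.range ((n + m) * r)).map (fun i : ℕ => r • (x * d) - (i + 1) • h)).prod *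
      x ^ (n + m) := by
  have hshift := SemiconjBy.list_prod_map
    (fun i => weyl_pow_semiconjBy hcentral hweyl r n (i + 1)) (List.range (m * r))
  rw [add_mul, List.range_add, List.map_append, List.prod_append, List.map_map, pow_add,
    mul_assoc, ← mul_assoc (x ^ n), hshift.eq]
  simp only [Function.comp_def, mul_assoc, add_assoc]
end
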